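/- arXiv:2002.07525 — 4 statements merged into one kernel-verified Lean document; each statement's English description precedes it below -/
import Mathlib

section
/- Let G be a finite group of odd order. Then no irreducible complex character of G has Frobenius–Schur indicator equal to −1; more precisely, ν₂(χ) = 1 if χ is the trivial character and ν₂(χ) = 0 for every nontrivial irreducible character χ. -/
open CategoryTheory

/-- The Frobenius–Schur indicator `ν₂(χ) = (1/|G|) ∑_{g ∈ G} χ(g²)` of a class function
`χ : G → ℂ`. -/
noncomputable def frobeniusSchurIndicator {G : Type*} [Group G] [Fintype G] (χ : G → ℂ) : ℂ :=
  (Fintype.card G : ℂ)⁻¹ * ∑ g : G, χ (g ^ 2)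

/-- The indicator of a class function on a group of odd order is its average, because squaring
permutes the group. -/
theorem frobeniusSchurIndicator_eq_average {G : Type*} [Group G] [Fintype G]
    (hodd : Odd (Fintype.card G)) (χ : G → ℂ) :
    frobeniusSchurIndicator χ = (Nat.card G : ℂ)⁻¹ * ∑ g : G, χ g := by
  have hcop : (Nat.card G).Coprime 2 := by
    rw [Nat.card_eq_fintype_card]
    exact Nat.coprime_two_right.mpr hodd
  rw [frobeniusSchurIndicator, Nat.card_eq_fintype_card]
  congr 1
  exact Equiv.sum_comp (powCoprime hcop) χ

theorem FDRep.character_of_trivial {G : Type} [Group G] :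
    (FDRep.of (Representation.trivial ℂ G ℂ)).character = fun _ => 1 := by
  ext g
  simp [FDRep.character]

theorem FDRep.simple_of_trivial {G : Type} [Group G] [Fintype G] :
    Simple (FDRep.of (Representation.trivial ℂ G ℂ)) := by
  rw [FDRep.simple_iff_char_is_norm_one]
  simp [FDRep.character_of_trivial]

/-- The average of an irreducible character other than the trivial one vanishes. -/
theorem FDRep.average_char_eq_zero {G : Type} [Group G] [Fintype G] (V : FDRep ℂ G) [Simple V]
    (hV : V.character ≠ fun _ => 1) :
    (Nat.card G : ℂ)⁻¹ * ∑ g : G, V.character g = 0 := by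
  have : Invertible (Nat.card G : ℂ) := invertibleOfNonzero (by simp)
  have := FDRep.simple_of_trivial (G := G)
  have horth := FDRep.char_orthonormal V (FDRep.of (Representation.trivial ℂ G ℂ))
  rw [if_neg] at horth
  · simpa [FDRep.character_of_trivial] using horth
  · rintro ⟨i⟩
    exact hV ((FDRep.char_iso i).trans FDRep.character_of_trivial)

/-- If `G` is a finite group of odd order, then no irreducible complex character of `G` has
Frobenius–Schur indicator `−1`; more precisely, `ν₂(χ) = 1` if `χ` is the trivial character
and `ν₂(χ) = 0` for every nontrivial irreducible character `χ`. -/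
theorem frobeniusSchurIndicator_of_odd_card
    {G : Type} [Group G] [Fintype G] (hodd : Odd (Fintype.card G))
    (V : FDRep ℂ G) (hV : Simple V) :
    frobeniusSchurIndicator V.character ≠ -1 ∧
    (V.character = (fun _ => 1) → frobeniusSchurIndicator V.character = 1) ∧
    (V.character ≠ (fun _ => 1) → frobeniusSchurIndicator V.character = 0) := by
  have htriv (h : V.character = fun _ => 1) : frobeniusSchurIndicator V.character = 1 := by
    simp [frobeniusSchurIndicator, h]
  have hnontriv (h : V.character ≠ fun _ => 1) : frobeniusSchurIndicator V.character = 0 := by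
    rw [frobeniusSchurIndicator_eq_average hodd, FDRep.average_char_eq_zero V h]
  refine ⟨?_, htriv, hnontriv⟩
  by_cases h : V.character = fun _ => 1
  · rw [htriv h]
    norm_num
  · rw [hnontriv h]
    norm_num
end

section
/- Let G be a non-abelian finite group such that every non-linear irreducible complex character χ of G (i.e., every irreducible χ with χ(1) > 1) has Frobenius–Schur indicator ν₂(χ) = −1. Then G is a 2-group. -/
open CategoryTheory

open scoped MonoidAlgebra

/-- `moduleTrace M a` is the trace of the `ℂ`-linear endomorphism `v ↦ a • v` of `M`. -/
noncomputable def moduleTrace {A : Type*} (M : Type*) [Ring A] [Algebra ℂ A] [AddCommGroup M]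
    [Module ℂ M] [Module A M] [IsScalarTower ℂ A M] : A →ₗ[ℂ] ℂ :=
  LinearMap.trace ℂ M ∘ₗ (Algebra.lsmul ℂ ℂ M).toLinearMap

section Algebra

variable {A M : Type*} [Ring A] [Algebra ℂ A] [AddCommGroup M] [Module ℂ M] [Module A M]
  [IsScalarTower ℂ A M]

theorem moduleTrace_apply (a : A) :
    moduleTrace M a = LinearMap.trace ℂ M (Algebra.lsmul ℂ ℂ M a) := rfl

theorem moduleTrace_eq_zero {a : A} (ha : ∀ v : M, a • v = 0) : moduleTrace M a = 0 := by
  have : Algebra.lsmul ℂ ℂ M a = 0 := LinearMap.ext ha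
  rw [moduleTrace_apply, this, map_zero]

theorem moduleTrace_eq_add_of_isCompl [FiniteDimensional ℂ M] {S C : Submodule A M}
    (hSC : IsCompl S C) (a : A) : moduleTrace M a = moduleTrace S a + moduleTrace C a := by
  let e : (S × C) ≃ₗ[ℂ] M := (Submodule.prodEquivOfIsCompl S C hSC).restrictScalars ℂ
  have key : e.conj (LinearMap.prodMap (Algebra.lsmul ℂ ℂ S a) (Algebra.lsmul ℂ ℂ C a)) =
      Algebra.lsmul ℂ ℂ M a := by
    ext v
    obtain ⟨w, rfl⟩ := e.surjective v
    simp [LinearEquiv.conj_apply, e]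
  have : FiniteDimensional ℂ S := inferInstanceAs (FiniteDimensional ℂ (S.restrictScalars ℂ))
  have : FiniteDimensional ℂ C := inferInstanceAs (FiniteDimensional ℂ (C.restrictScalars ℂ))
  rw [moduleTrace_apply, ← key, LinearMap.trace_conj', LinearMap.trace_prodMap']
  rfl

theorem exists_smul_eq_smul_of_finrank_le_one [FiniteDimensional ℂ M]
    (hM : Module.finrank ℂ M ≤ 1) (a : A) : ∃ s : ℂ, ∀ v : M, a • v = s • v := by
  obtain h | h := Nat.le_one_iff_eq_zero_or_eq_one.1 hM
  · have := Module.finrank_zero_iff.1 h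
    exact ⟨0, fun v ↦ Subsingleton.elim _ _⟩
  · obtain ⟨s, hs, -⟩ := LinearMap.existsUnique_eq_smul_id_of_finrank_eq_one h
      (Algebra.lsmul ℂ ℂ M a)
    exact ⟨s, fun v ↦ congr($hs v)⟩

/-- A central element acts on a simple module by a scalar. -/
theorem exists_smul_eq_smul_of_forall_commute [FiniteDimensional ℂ M] [IsSimpleModule A M] {z : A}
    (hz : ∀ a, Commute z a) : ∃ s : ℂ, ∀ v : M, z • v = s • v := by
  let f : Module.End A M :=
    { toFun := fun v ↦ z • v
      map_add' := smul_add z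
      map_smul' := fun a v ↦ by simp only [RingHom.id_apply, smul_smul, (hz a).eq] }
  obtain ⟨s, hs⟩ := (IsSimpleModule.algebraMap_end_bijective_of_isAlgClosed (A := A) (V := M) ℂ).2 f
  exact ⟨s, fun v ↦ congr($hs v).symm⟩

/-- For an idempotent `p`, the trace is the rank, hence a natural number, vanishing only if `p`
acts as zero. -/
theorem exists_nat_moduleTrace_eq_of_isIdempotentElem [FiniteDimensional ℂ M] {p : A}
    (hp : IsIdempotentElem p) :
    ∃ n : ℕ, moduleTrace M p = n ∧ (n = 0 → ∀ v : M, p • v = 0) := by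
  have hf : IsIdempotentElem (Algebra.lsmul ℂ ℂ M p) := hp.map _
  have := (LinearMap.IsIdempotentElem.isProj_range _ hf).trace
  refine ⟨_, this, fun h v ↦ ?_⟩
  rw [h, Nat.cast_zero, LinearMap.IsIdempotentElem.trace_eq_zero_iff hf] at this
  exact congr($this v)

/-- If a central element `z` has trace `-c` with `c > 0` on a simple module, then `z * p` has
nonpositive trace for each idempotent `p`, with equality only if `p` acts as zero. -/
theorem moduleTrace_mul_re_nonpos [FiniteDimensional ℂ M] [IsSimpleModule A M] {z p : A}
    (hz : ∀ a, Commute z a) (hp : IsIdempotentElem p) {c : ℕ} (hc : 0 < c)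
    (hzc : moduleTrace M z = -c) :
    (moduleTrace M (z * p)).re ≤ 0 ∧ (0 ≤ (moduleTrace M (z * p)).re → ∀ v : M, p • v = 0) := by
  obtain ⟨s, hs⟩ := exists_smul_eq_smul_of_forall_commute (M := M) hz
  obtain ⟨n, hn, hn0⟩ := exists_nat_moduleTrace_eq_of_isIdempotentElem (M := M) hp
  have hmul : ∀ a : A, moduleTrace M (z * a) = s * moduleTrace M a := by
    intro a
    have : Algebra.lsmul ℂ ℂ M (z * a) = s • Algebra.lsmul ℂ ℂ M a :=
      LinearMap.ext fun v ↦ by simp [hs]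
    rw [moduleTrace_apply, this, map_smul, smul_eq_mul, moduleTrace_apply]
  have hone : moduleTrace M (1 : A) = Module.finrank ℂ M := by
    rw [moduleTrace_apply, map_one, LinearMap.trace_one]
  have hsd : s * Module.finrank ℂ M = -c := by rw [← hone, ← hmul, mul_one, hzc]
  have : Nontrivial M := IsSimpleModule.nontrivial A M
  have hd : 0 < Module.finrank ℂ M := Module.finrank_pos
  set d := Module.finrank ℂ M
  have htr : moduleTrace M (z * p) = ((-(c * n / d : ℝ) : ℝ) : ℂ) := by
    have hd' : (d : ℂ) ≠ 0 := by exact_mod_cast hd.ne'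
    rw [hmul, hn]
    push_cast
    field_simp
    linear_combination n * hsd
  rw [htr, Complex.ofReal_re]
  refine ⟨neg_nonpos.2 (by positivity), fun h ↦ hn0 ?_⟩
  by_contra hn
  have : 0 < (c * n / d : ℝ) := by positivity
  linarith

end Algebra

section Group

variable {G : Type} [Group G]

/-- The idempotent averaging over the powers of `b`. -/
noncomputable def powAverage (b : G) : ℂ[G] :=
  (orderOf b : ℂ)⁻¹ • ∑ k ∈ Finset.range (orderOf b), MonoidAlgebra.of ℂ G (b ^ k)

theorem of_mul_powAverage (b : G) : MonoidAlgebra.of ℂ G b * powAverage b = powAverage b := by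
  rw [powAverage, mul_smul_comm, Finset.mul_sum]
  congr 1
  have h1 := Finset.sum_range_succ (fun k ↦ MonoidAlgebra.of ℂ G (b ^ k)) (orderOf b)
  have h2 := Finset.sum_range_succ' (fun k ↦ MonoidAlgebra.of ℂ G (b ^ k)) (orderOf b)
  rw [h1, pow_orderOf_eq_one, pow_zero, add_left_inj] at h2
  rw [h2]
  simp only [← map_mul, ← pow_succ']

/-- An element of odd order is the square of one of its powers. -/
theorem exists_pow_sq_eq {b : G} (hb : Odd (orderOf b)) : ∃ m : ℕ, (b ^ m) ^ 2 = b := by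
  obtain ⟨m, hm⟩ := hb
  refine ⟨m + 1, ?_⟩
  rw [← pow_mul, show (m + 1) * 2 = orderOf b + 1 by omega, pow_succ, pow_orderOf_eq_one, one_mul]

theorem mul_of_comm_of_finrank_le_one {S : Submodule ℂ[G] ℂ[G]} [FiniteDimensional ℂ S]
    (hS : Module.finrank ℂ S ≤ 1) (x y : ℂ[G]) {v : ℂ[G]} (hv : v ∈ S) :
    x * (y * v) = y * (x * v) := by
  obtain ⟨s, hs⟩ := exists_smul_eq_smul_of_finrank_le_one hS x
  have hs' : ∀ w ∈ S, x * w = s • w := fun w hw ↦ congr(($(hs ⟨w, hw⟩) : ℂ[G]))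
  rw [hs' v hv, hs' (y * v) (S.smul_mem y hv), mul_smul_comm]

/-- The automorphism `g ↦ χ g • g` of the group algebra attached to a linear character `χ`. -/
noncomputable def linearTwist (χ : G →* ℂˣ) : ℂ[G] →ₐ[ℂ] ℂ[G] :=
  MonoidAlgebra.lift ℂ ℂ[G] G
    { toFun := fun g ↦ (χ g : ℂ) • MonoidAlgebra.of ℂ G g
      map_one' := by rw [map_one, Units.val_one, one_smul, map_one]
      map_mul' := fun g k ↦ by simp only [map_mul, Units.val_mul, smul_mul_smul_comm] }

theorem linearTwist_of (χ : G →* ℂˣ) (g : G) :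
    linearTwist χ (MonoidAlgebra.of ℂ G g) = (χ g : ℂ) • MonoidAlgebra.of ℂ G g :=
  MonoidAlgebra.lift_of _ _

theorem linearTwist_inv_comp (χ : G →* ℂˣ) :
    (linearTwist χ⁻¹).comp (linearTwist χ) = AlgHom.id ℂ ℂ[G] := by
  refine MonoidAlgebra.algHom_ext (fun g ↦ ?_) (Subsingleton.elim _ _)
  change linearTwist χ⁻¹ (linearTwist χ (MonoidAlgebra.of ℂ G g)) = MonoidAlgebra.of ℂ G g
  rw [linearTwist_of, map_smul, linearTwist_of, smul_smul, MonoidHom.inv_apply,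
    Units.mul_inv, one_smul]

theorem linearTwist_bijective (χ : G →* ℂˣ) : Function.Bijective (linearTwist χ) := by
  refine Function.bijective_iff_has_inverse.2 ⟨linearTwist χ⁻¹, fun a ↦ ?_, fun a ↦ ?_⟩
  · exact congr($(linearTwist_inv_comp χ) a)
  · have := congr($(linearTwist_inv_comp χ⁻¹) a)
    rwa [show χ⁻¹⁻¹ = χ from MonoidHom.ext fun g ↦ inv_inv (χ g)] at this

end Group

section FiniteGroup

variable {G : Type} [Group G] [Fintype G]

/-- The central element `∑ g, g ^ 2` of the group algebra. -/
noncomputable def sumSq (G : Type) [Group G] [Fintype G] : ℂ[G] :=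
  ∑ g : G, MonoidAlgebra.of ℂ G (g ^ 2)

theorem commute_sumSq (a : ℂ[G]) : Commute (sumSq G) a := by
  induction a using MonoidAlgebra.induction_on with
  | of g =>
    rw [commute_iff_eq, sumSq, Finset.sum_mul, Finset.mul_sum]
    simp only [← map_mul]
    refine Fintype.sum_equiv (MulAut.conj g⁻¹).toEquiv _ _ fun x ↦ ?_
    congr 1
    simp [sq, mul_assoc]
  | add x y hx hy => exact hx.add_right hy
  | smul c x hx => exact hx.smul_right c

theorem isIdempotentElem_powAverage (b : G) : IsIdempotentElem (powAverage b) := by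
  have h : ∀ k : ℕ, MonoidAlgebra.of ℂ G (b ^ k) * powAverage b = powAverage b := by
    intro k
    induction k with
    | zero => rw [pow_zero, map_one, one_mul]
    | succ k ih => rw [pow_succ, map_mul, mul_assoc, of_mul_powAverage, ih]
  have hb : (orderOf b : ℂ) ≠ 0 := by exact_mod_cast (orderOf_pos b).ne'
  rw [IsIdempotentElem]
  conv_lhs => enter [1]; rw [powAverage]
  rw [smul_mul_assoc, Finset.sum_mul, Finset.sum_congr rfl fun k _ ↦ h k, Finset.sum_const,
    Finset.card_range, ← Nat.cast_smul_eq_nsmul ℂ, smul_smul, inv_mul_cancel₀ hb, one_smul]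

open scoped Classical in
theorem moduleTrace_regular_of (g : G) :
    moduleTrace ℂ[G] (MonoidAlgebra.of ℂ G g) = if g = 1 then (Fintype.card G : ℂ) else 0 := by
  rw [moduleTrace_apply, LinearMap.trace_eq_matrix_trace ℂ (MonoidAlgebra.basis G ℂ)]
  have h : ∀ x : G, LinearMap.toMatrix (MonoidAlgebra.basis G ℂ) (MonoidAlgebra.basis G ℂ)
      (Algebra.lsmul ℂ ℂ ℂ[G] (MonoidAlgebra.of ℂ G g)) x x = if g = 1 then 1 else 0 := by
    intro x
    rw [LinearMap.toMatrix_apply]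
    simp [MonoidAlgebra.basis, Finsupp.single_apply]
  simp only [Matrix.trace, Matrix.diag_apply, h]
  split_ifs <;> simp

open scoped Classical in
theorem moduleTrace_regular_sumSq_mul_of (c : G) :
    moduleTrace ℂ[G] (sumSq G * MonoidAlgebra.of ℂ G c) =
      Fintype.card G * (Finset.univ.filter fun x : G ↦ x ^ 2 * c = 1).card := by
  rw [sumSq, Finset.sum_mul, map_sum]
  simp only [← map_mul, moduleTrace_regular_of, ← Finset.sum_filter, Finset.sum_const,
    nsmul_eq_mul, mul_comm]

open scoped Classical in
/-- An inverse of an element of odd order has at most as many square roots as `1`. -/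
theorem card_sq_mul_eq_one_le {c : G} (hc : Odd (orderOf c)) :
    (Finset.univ.filter fun x : G ↦ x ^ 2 * c = 1).card ≤
      (Finset.univ.filter fun x : G ↦ x ^ 2 = 1).card := by
  obtain ⟨m, hm⟩ := exists_pow_sq_eq hc
  refine Finset.card_le_card_of_injOn (· * c ^ m) (fun x hx ↦ ?_) (mul_left_injective _).injOn
  simp only [Finset.coe_filter, Finset.mem_univ, true_and, Set.mem_ofPred_eq] at hx ⊢
  have hcx : c = (x ^ 2)⁻¹ := (inv_eq_of_mul_eq_one_right hx).symm
  have hcomm : Commute x (c ^ m) := by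
    refine Commute.pow_right ?_ m
    rw [hcx]
    exact ((Commute.refl x).pow_right 2).inv_right
  rw [hcomm.mul_pow, hm, hx]

theorem moduleTrace_regular_re_nonneg {b : G} (hb : Odd (orderOf b)) :
    0 ≤ (moduleTrace ℂ[G] (sumSq G * (1 - powAverage b))).re := by
  classical
  have h1 := moduleTrace_regular_sumSq_mul_of (1 : G)
  simp only [mul_one, map_one] at h1
  have h2 : moduleTrace ℂ[G] (sumSq G * powAverage b) = (orderOf b : ℂ)⁻¹ *
      ∑ k ∈ Finset.range (orderOf b),
        Fintype.card G * ((Finset.univ.filter fun x : G ↦ x ^ 2 * b ^ k = 1).card : ℂ) := by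
    rw [powAverage, mul_smul_comm, map_smul, Finset.mul_sum, map_sum, smul_eq_mul]
    simp only [moduleTrace_regular_sumSq_mul_of]
  rw [mul_sub, mul_one, map_sub, h1, h2]
  have hn : (0 : ℝ) < orderOf b := by exact_mod_cast orderOf_pos b
  have key : (orderOf b : ℝ)⁻¹ * ∑ k ∈ Finset.range (orderOf b),
      Fintype.card G * ((Finset.univ.filter fun x : G ↦ x ^ 2 * b ^ k = 1).card : ℝ) ≤
      Fintype.card G * (Finset.univ.filter fun x : G ↦ x ^ 2 = 1).card := by
    rw [inv_mul_le_iff₀ hn]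
    refine (Finset.sum_le_card_nsmul _ _
      (Fintype.card G * (Finset.univ.filter fun x : G ↦ x ^ 2 = 1).card : ℝ)
      fun k _ ↦ ?_).trans_eq ?_
    · exact mul_le_mul_of_nonneg_left (Nat.cast_le.2
        (card_sq_mul_eq_one_le (hb.of_dvd_nat (orderOf_pow_dvd k)))) (Nat.cast_nonneg _)
    · rw [Finset.card_range, nsmul_eq_mul]
  refine (sub_nonneg.2 key).trans_eq ?_
  rw [← Complex.ofReal_re (_ - _)]
  push_cast
  rfl

section Module

variable {M : Type} [AddCommGroup M] [Module ℂ M] [Module ℂ[G] M] [IsScalarTower ℂ ℂ[G] M]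
  [FiniteDimensional ℂ M]

/-- On a one-dimensional module, `∑ g, g ^ 2` absorbs squares. -/
theorem moduleTrace_sumSq_mul_eq_zero (hM : Module.finrank ℂ M ≤ 1) {b : G}
    (hb : Odd (orderOf b)) : moduleTrace M (sumSq G * (1 - powAverage b)) = 0 := by
  have hcomm : ∀ (a c : ℂ[G]) (v : M), a • c • v = c • a • v := by
    intro a c v
    obtain ⟨s, hs⟩ := exists_smul_eq_smul_of_finrank_le_one hM a
    rw [hs, hs, smul_algebra_smul_comm]
  have hodd : ∀ (c : G) (v : M), Odd (orderOf c) →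
      (sumSq G * MonoidAlgebra.of ℂ G c) • v = sumSq G • v := by
    intro c v hc
    obtain ⟨m, hm⟩ := exists_pow_sq_eq hc
    rw [sumSq, Finset.sum_mul, Finset.sum_smul, Finset.sum_smul]
    refine Fintype.sum_equiv (Equiv.mulRight (c ^ m)) _ _ fun x ↦ ?_
    nth_rewrite 1 [← hm]
    simp only [Equiv.coe_mulRight, pow_two, map_mul, mul_smul]
    rw [hcomm (MonoidAlgebra.of ℂ G (c ^ m)) (MonoidAlgebra.of ℂ G x)]
  refine moduleTrace_eq_zero fun v ↦ ?_
  have hn : (orderOf b : ℂ) ≠ 0 := by exact_mod_cast (orderOf_pos b).ne'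
  rw [mul_sub, mul_one, sub_smul, sub_eq_zero, powAverage, mul_smul_comm, smul_assoc,
    Finset.mul_sum, Finset.sum_smul,
    Finset.sum_congr rfl fun k _ ↦ hodd _ v (hb.of_dvd_nat (orderOf_pow_dvd k)),
    Finset.sum_const, Finset.card_range, ← Nat.cast_smul_eq_nsmul ℂ, smul_smul,
    inv_mul_cancel₀ hn, one_smul]

theorem moduleTrace_sumSq [IsSimpleModule ℂ[G] M] (hM : 1 < Module.finrank ℂ M)
    (h : ∀ V : FDRep ℂ G, Simple V → 1 < Module.finrank ℂ V →
      frobeniusSchurIndicator V.character = -1) :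
    moduleTrace M (sumSq G) = -(Fintype.card G : ℂ) := by
  let ρ : Representation ℂ G M := Representation.ofModule' M
  have : ρ.IsIrreducible := by
    rw [Representation.irreducible_iff_isSimpleModule_asModule]
    let e : ρ.asModule ≃ₗ[ℂ[G]] M :=
      { ρ.asModuleEquiv with
        map_smul' := fun a v ↦ by
          refine (ρ.asModuleEquiv_map_smul a v).trans ?_
          have : ρ.asAlgebraHom = Algebra.lsmul ℂ ℂ M :=
            (MonoidAlgebra.lift ℂ (M →ₗ[ℂ] M) G).apply_symm_apply _
          rw [this]
          rfl }
    exact IsSimpleModule.congr e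
  have hs : Simple (FDRep.of ρ) := by
    have : Invertible (Nat.card G : ℂ) := invertibleOfNonzero (NeZero.ne _)
    rw [FDRep.simple_iff_char_is_norm_one]
    have := ρ.char_orthonormal ρ
    rw [if_pos ⟨.refl ρ⟩, inv_mul_eq_one₀ (NeZero.ne _)] at this
    exact this.symm
  have hν := h (FDRep.of ρ) hs hM
  rw [frobeniusSchurIndicator, inv_mul_eq_iff_eq_mul₀ (by simp), mul_neg, mul_one] at hν
  rw [← hν, sumSq, map_sum]
  rfl

theorem moduleTrace_re_nonpos_of_isSimpleModule [IsSimpleModule ℂ[G] M]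
    (h : ∀ V : FDRep ℂ G, Simple V → 1 < Module.finrank ℂ V →
      frobeniusSchurIndicator V.character = -1)
    {b : G} (hb : Odd (orderOf b)) : (moduleTrace M (sumSq G * (1 - powAverage b))).re ≤ 0 := by
  by_cases hM : Module.finrank ℂ M ≤ 1
  · rw [moduleTrace_sumSq_mul_eq_zero hM hb, Complex.zero_re]
  · exact (moduleTrace_mul_re_nonpos commute_sumSq (isIdempotentElem_powAverage b).one_sub
      Fintype.card_pos (moduleTrace_sumSq (not_le.1 hM) h)).1

theorem moduleTrace_re_nonpos
    (h : ∀ V : FDRep ℂ G, Simple V → 1 < Module.finrank ℂ V →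
      frobeniusSchurIndicator V.character = -1)
    {b : G} (hb : Odd (orderOf b)) (n : ℕ) :
    ∀ (M : Type) [AddCommGroup M] [Module ℂ M] [Module ℂ[G] M] [IsScalarTower ℂ ℂ[G] M]
      [FiniteDimensional ℂ M], Module.finrank ℂ M = n →
      (moduleTrace M (sumSq G * (1 - powAverage b))).re ≤ 0 := by
  induction n using Nat.strong_induction_on with
  | _ n ih =>
    intro M _ _ _ _ _ hn
    obtain hM | hM := subsingleton_or_nontrivial M
    · rw [moduleTrace_eq_zero fun v ↦ Subsingleton.elim _ _, Complex.zero_re]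
    obtain ⟨S, hS⟩ := IsSemisimpleModule.exists_simple_submodule ℂ[G] M
    obtain ⟨C, hC⟩ := exists_isCompl S
    have : FiniteDimensional ℂ S := inferInstanceAs (FiniteDimensional ℂ (S.restrictScalars ℂ))
    have : FiniteDimensional ℂ C := inferInstanceAs (FiniteDimensional ℂ (C.restrictScalars ℂ))
    have hlt : Module.finrank ℂ C < n := by
      rw [← hn]
      refine Submodule.finrank_lt (s := C.restrictScalars ℂ) fun htop ↦ ?_
      rw [Submodule.restrictScalars_eq_top_iff] at htop
      have hbot : S = ⊥ := by simpa [htop] using hC.inf_eq_bot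
      exact (isSimpleModule_iff_isAtom.1 hS).1 hbot
    rw [moduleTrace_eq_add_of_isCompl hC, Complex.add_re]
    exact add_nonpos (moduleTrace_re_nonpos_of_isSimpleModule h hb) (ih _ hlt C rfl)

end Module

instance : FiniteDimensional ℂ ℂ[G] := Module.Finite.of_basis (MonoidAlgebra.basis G ℂ)

instance (S : Submodule ℂ[G] ℂ[G]) : FiniteDimensional ℂ S :=
  inferInstanceAs (FiniteDimensional ℂ (S.restrictScalars ℂ))

/-- If all nonlinear characters have indicator `-1`, then elements of odd order act trivially on
the simple left ideals of the group algebra of dimension greater than one. -/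
theorem of_mul_eq_of_one_lt_finrank
    (h : ∀ V : FDRep ℂ G, Simple V → 1 < Module.finrank ℂ V →
      frobeniusSchurIndicator V.character = -1)
    {b : G} (hb : Odd (orderOf b)) (S : Submodule ℂ[G] ℂ[G]) [IsSimpleModule ℂ[G] S]
    (hS : 1 < Module.finrank ℂ S) {v : ℂ[G]} (hv : v ∈ S) : MonoidAlgebra.of ℂ G b * v = v := by
  obtain ⟨C, hC⟩ := exists_isCompl S
  have hreg := moduleTrace_regular_re_nonneg hb
  rw [moduleTrace_eq_add_of_isCompl hC, Complex.add_re] at hreg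
  have hfix : powAverage b * v = v := by
    have := (moduleTrace_mul_re_nonpos commute_sumSq (isIdempotentElem_powAverage b).one_sub
      Fintype.card_pos (moduleTrace_sumSq hS h)).2
        (by linarith [moduleTrace_re_nonpos h hb _ C rfl]) ⟨v, hv⟩
    have : (1 - powAverage b) * v = 0 := congr(($this : ℂ[G]))
    rw [sub_mul, one_mul, sub_eq_zero] at this
    exact this.symm
  rw [← hfix, ← mul_assoc, of_mul_powAverage]

/-- An element of the group algebra killing all simple left ideals vanishes. -/
theorem eq_zero_of_forall_simple_mul_eq_zero {a : ℂ[G]}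
    (ha : ∀ S : Submodule ℂ[G] ℂ[G], IsSimpleModule ℂ[G] S → ∀ v ∈ S, a * v = 0) : a = 0 := by
  have key : ∀ v ∈ sSup {S : Submodule ℂ[G] ℂ[G] | IsSimpleModule ℂ[G] S}, a * v = 0 := by
    intro v hv
    rw [sSup_eq_iSup'] at hv
    induction hv using Submodule.iSup_induction' with
    | mem S v hv => exact ha S S.2 v hv
    | zero => exact mul_zero a
    | add x y _ _ hx hy => rw [mul_add, hx, hy, add_zero]
  simpa using key 1 (by rw [IsSemisimpleModule.sSup_simples_eq_top]; trivial)

theorem exists_simple_not_commute (hna : ¬ ∀ a b : G, a * b = b * a) :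
    ∃ S : Submodule ℂ[G] ℂ[G], IsSimpleModule ℂ[G] S ∧ ∃ (x y : G), ∃ v ∈ S,
      MonoidAlgebra.of ℂ G (x * y) * v ≠ MonoidAlgebra.of ℂ G (y * x) * v := by
  by_contra! hall
  refine hna fun x y ↦ MonoidAlgebra.of_injective (R := ℂ) (sub_eq_zero.1 ?_)
  refine eq_zero_of_forall_simple_mul_eq_zero fun S hS v hv ↦ ?_
  rw [sub_mul, hall S hS x y v hv, sub_self]

/-- Twisting by linear characters shows that elements of odd order lie in the kernel of every
linear character. -/
theorem linearCharacter_eq_one (hna : ¬ ∀ a b : G, a * b = b * a)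
    (h : ∀ V : FDRep ℂ G, Simple V → 1 < Module.finrank ℂ V →
      frobeniusSchurIndicator V.character = -1)
    {b : G} (hb : Odd (orderOf b)) (χ : G →* ℂˣ) : χ b = 1 := by
  obtain ⟨S, hS, x, y, v, hv, hxy⟩ := exists_simple_not_commute hna
  have hfin : ∀ (T : Submodule ℂ[G] ℂ[G]), ∀ w ∈ T,
      MonoidAlgebra.of ℂ G (x * y) * w ≠ MonoidAlgebra.of ℂ G (y * x) * w →
      1 < Module.finrank ℂ T := by
    intro T w hw hne
    by_contra! hT
    refine hne ?_
    simpa only [map_mul, mul_assoc] using mul_of_comm_of_finrank_le_one hT _ _ hw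
  have : RingHomSurjective (linearTwist χ : ℂ[G] →+* ℂ[G]) := ⟨(linearTwist_bijective χ).2⟩
  let f : ℂ[G] →ₛₗ[(linearTwist χ : ℂ[G] →+* ℂ[G])] ℂ[G] :=
    { toFun := linearTwist χ
      map_add' := map_add _
      map_smul' := map_mul _ }
  have hT : IsSimpleModule ℂ[G] (S.map f) := by
    rw [isSimpleModule_iff_isAtom] at hS ⊢
    exact ((Submodule.orderIsoMapComapOfBijective f (linearTwist_bijective χ)).isAtom_iff S).2 hS
  have hv0 : v ≠ 0 := by
    rintro rfl
    simp at hxy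
  have hfv : linearTwist χ v ∈ S.map f := Submodule.mem_map_of_mem (f := f) hv
  have h1 := of_mul_eq_of_one_lt_finrank h hb S (hfin S v hv hxy) hv
  have h2 := of_mul_eq_of_one_lt_finrank h hb (S.map f) (hfin _ _ hfv fun heq ↦ hxy ?_) hfv
  · have h3 := congr(linearTwist χ $h1)
    rw [map_mul, linearTwist_of, smul_mul_assoc, h2] at h3
    have hne : linearTwist χ v ≠ 0 :=
      (map_ne_zero_iff _ (linearTwist_bijective χ).1).2 hv0
    exact Units.ext (smul_left_injective ℂ hne (h3.trans (one_smul ℂ _).symm))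
  · apply (linearTwist_bijective χ).1
    rw [map_mul (linearTwist χ), map_mul (linearTwist χ), linearTwist_of, linearTwist_of,
      smul_mul_assoc, smul_mul_assoc, heq, map_mul χ, map_mul χ, mul_comm (χ x)]

theorem eq_one_of_odd_orderOf (hna : ¬ ∀ a b : G, a * b = b * a)
    (h : ∀ V : FDRep ℂ G, Simple V → 1 < Module.finrank ℂ V →
      frobeniusSchurIndicator V.character = -1)
    {b : G} (hb : Odd (orderOf b)) : b = 1 := by
  refine MonoidAlgebra.of_injective (R := ℂ) (sub_eq_zero.1 ?_)
  refine eq_zero_of_forall_simple_mul_eq_zero fun S hS v hv ↦ ?_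
  rw [map_one, sub_mul, one_mul, sub_eq_zero]
  obtain hd | hd := lt_or_ge 1 (Module.finrank ℂ S)
  · exact of_mul_eq_of_one_lt_finrank h hb S hd hv
  have := IsSimpleModule.nontrivial ℂ[G] S
  have hd1 : Module.finrank ℂ S = 1 := le_antisymm hd Module.finrank_pos
  have hdet := linearCharacter_eq_one hna h hb
    (LinearMap.det.comp (Representation.ofModule' (k := ℂ) (G := G) S)).toHomUnits
  obtain ⟨s, hs⟩ := exists_smul_eq_smul_of_finrank_le_one hd (MonoidAlgebra.of ℂ G b)
  have hρ : Representation.ofModule' S b = s • (LinearMap.id : S →ₗ[ℂ] S) :=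
    LinearMap.ext fun w ↦ by
      rw [LinearMap.smul_apply, LinearMap.id_apply, ← hs w]
      rfl
  have hs1 : s = 1 := by
    have := congr(($hdet : ℂ))
    simpa [hρ, hd1] using this
  have := congr(($(hs ⟨v, hv⟩) : ℂ[G]))
  simpa [hs1] using this

end FiniteGroup

/-- Let `G` be a non-abelian finite group such that every non-linear irreducible complex
character of `G` (i.e. every irreducible character of a representation of dimension `> 1`)
has Frobenius–Schur indicator `−1`. Then `G` is a `2`-group. -/
theorem isPGroup_two_of_nonlinear_characters_quaternionic
    {G : Type} [Group G] [Fintype G]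
    (hna : ¬ ∀ a b : G, a * b = b * a)
    (h : ∀ V : FDRep ℂ G, Simple V → 1 < Module.finrank ℂ V →
      frobeniusSchurIndicator V.character = -1) :
    IsPGroup 2 G := by
  intro g
  obtain ⟨k, m, hm, hkm⟩ := Nat.exists_eq_two_pow_mul_odd (orderOf_pos g).ne'
  refine ⟨k, eq_one_of_odd_orderOf hna h ?_⟩
  rw [orderOf_pow_of_dvd (by positivity) ⟨m, hkm⟩, hkm, Nat.mul_div_cancel_left _ (by positivity)]
  exact hm
end

section
/- Let G be a finite group possessing an irreducible complex character with Frobenius–Schur indicator equal to −1. Then 2·I(G) ≤ |G|, where I(G) denotes the number of elements g ∈ G with g² = 1. -/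
open CategoryTheory

/-- The trace of a complex endomorphism of finite order is bounded by the dimension. -/
theorem LinearMap.norm_trace_le_finrank_of_pow_eq_one {V : Type*} [AddCommGroup V] [Module ℂ V]
    [FiniteDimensional ℂ V] {f : Module.End ℂ V} {n : ℕ} (hn : n ≠ 0) (hf : f ^ n = 1) :
    ‖LinearMap.trace ℂ V f‖ ≤ Module.finrank ℂ V := by
  have hs : f.charpoly.Splits := IsAlgClosed.splits _
  have hroot (μ : ℂ) (hμ : μ ∈ f.charpoly.roots) : ‖μ‖ = 1 := by
    have he : f.HasEigenvalue μ :=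
      (Module.End.hasEigenvalue_iff_isRoot_charpoly f μ).2 (Polynomial.isRoot_of_mem_roots hμ)
    obtain ⟨v, hv⟩ := (he.pow n).exists_hasEigenvector
    have hv' : (1 : ℂ) • v = μ ^ n • v := by simpa [hf] using hv.apply_eq_smul
    exact Complex.norm_eq_one_of_pow_eq_one (smul_left_injective ℂ hv.2 hv').symm hn
  rw [Module.End.trace_eq_sum_roots_charpoly_of_splits hs]
  refine (norm_multiset_sum_le _).trans ?_
  rw [Multiset.map_congr rfl hroot]
  simp [← hs.natDegree_eq_card_roots, LinearMap.charpoly_natDegree]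

/-- A character value of a finite group is bounded in absolute value by the degree. -/
theorem FDRep.norm_character_le_finrank {G : Type*} [Group G] [Finite G] (V : FDRep ℂ G) (g : G) :
    ‖V.character g‖ ≤ Module.finrank ℂ V :=
  LinearMap.norm_trace_le_finrank_of_pow_eq_one (orderOf_pos g).ne'
    (by rw [← map_pow, pow_orderOf_eq_one, map_one])

/-- Let `G` be a finite group possessing an irreducible complex character with
Frobenius–Schur indicator `−1`. Then `2·I(G) ≤ |G|`, where `I(G)` denotes the number of
elements `g ∈ G` with `g² = 1`. -/
theorem two_mul_card_sq_eq_one_le_card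
    {G : Type} [Group G] [Fintype G]
    (h : ∃ V : FDRep ℂ G, Simple V ∧ frobeniusSchurIndicator V.character = -1) :
    2 * Nat.card {g : G // g ^ 2 = 1} ≤ Fintype.card G := by
  classical
  obtain ⟨V, -, hV⟩ := h
  set d : ℝ := (Module.finrank ℂ V : ℝ)
  have hG : (0 : ℝ) < Fintype.card G := by exact_mod_cast Fintype.card_pos
  have hsum : ∑ g : G, (V.character (g ^ 2)).re = -Fintype.card G := by
    have hG' : (Fintype.card G : ℂ) ≠ 0 := by exact_mod_cast hG.ne'
    rw [frobeniusSchurIndicator, inv_mul_eq_iff_eq_mul₀ hG'] at hV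
    simpa using congrArg Complex.re hV
  have hle (g : G) : (if g ^ 2 = 1 then 2 * d else 0) - d ≤ (V.character (g ^ 2)).re := by
    split_ifs with hg
    · rw [hg, FDRep.char_one, Complex.natCast_re]
      linarith
    · have h₁ := FDRep.norm_character_le_finrank V (g ^ 2)
      have h₂ := neg_le_of_abs_le ((Complex.abs_re_le_norm _).trans h₁)
      linarith
  have hbound := Finset.sum_le_sum fun g (_ : g ∈ Finset.univ) => hle g
  rw [hsum, Finset.sum_sub_distrib, ← Finset.sum_filter, Finset.sum_const, Finset.sum_const,
    Finset.card_univ, nsmul_eq_mul, nsmul_eq_mul, ← Fintype.card_subtype,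
    ← Nat.card_eq_fintype_card (α := {g : G // g ^ 2 = 1})] at hbound
  by_contra! hlt
  have hlt' : (Fintype.card G : ℝ) < 2 * Nat.card {g : G // g ^ 2 = 1} := by exact_mod_cast hlt
  have hd0 : 0 ≤ d := Nat.cast_nonneg _
  nlinarith [mul_nonneg hd0 (sub_nonneg.2 hlt'.le)]
end

section
/- Let n ≥ 5. Then the alternating group A_n has no irreducible complex representation of quaternionic type: every irreducible complex character χ of A_n satisfies ν₂(χ) ∈ {0, 1}, i.e., no irreducible character of A_n has Frobenius–Schur indicator −1. -/
open CategoryTheory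

open Module

section PermConj

/-- Every permutation is conjugate to its inverse by a permutation fixing a given point. -/
theorem Equiv.Perm.exists_conj_eq_inv_of_apply_eq {α : Type*} (g : Equiv.Perm α) (a : α) :
    ∃ h : Equiv.Perm α, h a = a ∧ h * g * h⁻¹ = g⁻¹ := by
  classical
  obtain ⟨r, hra, hr, hrep⟩ : ∃ r : α → α, r a = a ∧ (∀ x, g.SameCycle (r x) x) ∧
      ∀ x y, g.SameCycle x y → r x = r y := by
    let q (x : α) : α := (Quotient.mk (Equiv.Perm.SameCycle.setoid g) x).out
    have hq (x : α) : g.SameCycle (q x) x :=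
      Quotient.exact (s := Equiv.Perm.SameCycle.setoid g) (Quotient.out_eq _)
    refine ⟨fun x ↦ if g.SameCycle a x then a else q x, if_pos (.refl g a), fun x ↦ ?_,
      fun x y hxy ↦ ?_⟩
    · dsimp only
      split_ifs with h
      exacts [h, hq x]
    · have hqxy : q x = q y :=
        congrArg Quotient.out (Quotient.sound (s := Equiv.Perm.SameCycle.setoid g) hxy)
      have : g.SameCycle a x ↔ g.SameCycle a y := ⟨fun h ↦ h.trans hxy, fun h ↦ h.trans hxy.symm⟩
      simp only [this, hqxy]
  choose k hk using hr
  have hpow (x : α) (i j : ℤ) (h : (g ^ i) x = (g ^ j) x) : (g ^ (-i)) x = (g ^ (-j)) x := by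
    have := congrArg (g ^ (-i - j)) h
    simp only [← Equiv.Perm.mul_apply, ← zpow_add] at this
    convert this.symm using 3 <;> ring_nf
  let f (x : α) : α := (g ^ (-k x)) (r x)
  have hfr (x : α) (i : ℤ) (hx : (g ^ i) (r x) = x) : f x = (g ^ (-i)) (r x) :=
    hpow _ _ _ ((hk x).trans hx.symm)
  have hrf (x : α) : r (f x) = r x :=
    hrep _ _ ((Equiv.Perm.SameCycle.symm ⟨-k x, rfl⟩).trans ⟨k x, hk x⟩)
  have hff : Function.Involutive f := fun x ↦ by
    rw [hfr (f x) (-k x) (by rw [hrf]), hrf, neg_neg, hk]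
  have hfg (x : α) : f (g x) = g⁻¹ (f x) := by
    have hrg : r (g x) = r x := hrep _ _ (Equiv.Perm.SameCycle.symm ⟨1, by simp⟩)
    rw [hfr (g x) (k x + 1) (by rw [hrg, add_comm, zpow_add, Equiv.Perm.mul_apply, hk, zpow_one]),
      hrg, neg_add_rev, zpow_add, Equiv.Perm.mul_apply, zpow_neg_one]
  refine ⟨hff.toPerm, ?_, ?_⟩
  · change f a = a
    rw [hfr a 0 (by simp [hra]), hra]
    simp
  · rw [mul_inv_eq_iff_eq_mul]
    exact Equiv.ext hfg

/-- The inclusion of `Perm α` in `Perm (Option α)` as the stabilizer of `none`. -/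
def Equiv.Perm.optionCongrMonoidHom (α : Type*) : Equiv.Perm α →* Equiv.Perm (Option α) where
  toFun := Equiv.optionCongr
  map_one' := Equiv.optionCongr_one
  map_mul' e f := Equiv.ext fun x ↦ by cases x <;> rfl

theorem Equiv.Perm.exists_optionCongr_conj_eq_inv {α : Type*} (g : Equiv.Perm (Option α)) :
    ∃ h : Equiv.Perm α,
      optionCongrMonoidHom α h * g * (optionCongrMonoidHom α h)⁻¹ = g⁻¹ := by
  classical
  obtain ⟨h, hnone, hconj⟩ := g.exists_conj_eq_inv_of_apply_eq none
  refine ⟨Equiv.removeNone h, ?_⟩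
  have : optionCongrMonoidHom α (Equiv.removeNone h) = h := by
    change (Equiv.removeNone h).optionCongr = h
    rw [map_equiv_removeNone, hnone, Equiv.swap_self]
    rfl
  rw [this, hconj]

end PermConj

namespace Representation

section Irreducible

variable {k G V : Type*} [Field k] [Group G] [AddCommGroup V] [Module k V]
  {ρ : Representation k G V}

theorem isIrreducible_iff_forall_invariant :
    ρ.IsIrreducible ↔ Nontrivial V ∧
      ∀ p : Submodule k V, (∀ g, ∀ v ∈ p, ρ g v ∈ p) → p = ⊥ ∨ p = ⊤ := by
  constructor
  · intro h
    refine ⟨?_, fun p hp ↦ ?_⟩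
    · by_contra! hV
      exact bot_ne_top (α := Subrepresentation ρ)
        (Subrepresentation.toSubmodule_injective (Subsingleton.elim _ _))
    · exact (eq_bot_or_eq_top (⟨p, fun g v hv ↦ hp g v hv⟩ : Subrepresentation ρ)).imp
        (congrArg Subrepresentation.toSubmodule) (congrArg Subrepresentation.toSubmodule)
  · rintro ⟨_, h⟩
    exact
      { exists_pair_ne := ⟨⊥, ⊤, fun e ↦
          bot_ne_top (α := Submodule k V) (congrArg Subrepresentation.toSubmodule e)⟩
        eq_bot_or_eq_top := fun p ↦
          (h p.toSubmodule fun g _ hv ↦ p.apply_mem_toSubmodule g hv).imp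
            (fun e ↦ Subrepresentation.toSubmodule_injective e)
            (fun e ↦ Subrepresentation.toSubmodule_injective e) }

theorem IsIrreducible.nontrivial (h : ρ.IsIrreducible) : Nontrivial V :=
  (isIrreducible_iff_forall_invariant.mp h).1

theorem IsIrreducible.eq_bot_or_eq_top_of_invariant (h : ρ.IsIrreducible) (p : Submodule k V)
    (hp : ∀ g, ∀ v ∈ p, ρ g v ∈ p) : p = ⊥ ∨ p = ⊤ :=
  (isIrreducible_iff_forall_invariant.mp h).2 p hp

theorem IsIrreducible.of_ker_eq_bot_of_range_eq_top {W : Type*} [AddCommGroup W] [Module k W]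
    {σ : Representation k G W} (h : ρ.IsIrreducible) (f : W →ₗ[k] V)
    (hf : ∀ g w, f (σ g w) = ρ g (f w)) (hker : LinearMap.ker f = ⊥)
    (hrange : LinearMap.range f = ⊤) : σ.IsIrreducible := by
  have := h.nontrivial
  have hfinj := Submodule.map_injective_of_injective (LinearMap.ker_eq_bot.mp hker)
  refine isIrreducible_iff_forall_invariant.mpr
    ⟨(LinearMap.range_eq_top.mp hrange).nontrivial, fun p hp ↦ ?_⟩
  refine (h.eq_bot_or_eq_top_of_invariant (p.map f) ?_).imp (fun h ↦ hfinj ?_) fun h ↦ hfinj ?_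
  · rintro g _ ⟨w, hw, rfl⟩
    exact ⟨σ g w, hp g w hw, hf g w⟩
  · rw [h, Submodule.map_bot]
  · rw [h, Submodule.map_top, hrange]

variable (ρ) in
theorem exists_isIrreducible_subrepresentation [FiniteDimensional k V] [Nontrivial V] :
    ∃ W : Subrepresentation ρ, W.toRepresentation.IsIrreducible := by
  obtain ⟨W, hW, hmin⟩ := (InvImage.wf (fun W : Subrepresentation ρ ↦ finrank k W.toSubmodule)
    Nat.lt_wfRel.wf).has_min {W | W.toSubmodule ≠ ⊥} ⟨⊤, top_ne_bot (α := Submodule k V)⟩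
  refine ⟨W, isIrreducible_iff_forall_invariant.mpr
    ⟨Submodule.nontrivial_iff_ne_bot.mpr hW, fun p hp ↦ or_iff_not_imp_left.mpr fun hne ↦ ?_⟩⟩
  let U : Subrepresentation ρ := ⟨p.map W.toSubmodule.subtype, by
    rintro g _ ⟨v, hv, rfl⟩
    exact ⟨W.toRepresentation g v, hp g v hv, rfl⟩⟩
  have hU : U ∈ {W : Subrepresentation ρ | W.toSubmodule ≠ ⊥} := fun h ↦
    hne (Submodule.map_injective_of_injective W.toSubmodule.injective_subtype
      (h.trans (Submodule.map_bot _).symm))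
  have hle : finrank k W.toSubmodule ≤ finrank k U.toSubmodule := not_lt.mp (hmin U hU)
  rw [LinearEquiv.finrank_eq
    (p.equivMapOfInjective _ W.toSubmodule.injective_subtype).symm] at hle
  exact Submodule.eq_top_of_finrank_eq (le_antisymm (Submodule.finrank_le p) hle)

/-- **Burnside's theorem**: the operators of an irreducible representation over an algebraically
closed field span the whole endomorphism algebra. -/
theorem IsIrreducible.span_range_eq_top [IsAlgClosed k] [FiniteDimensional k V]
    (h : ρ.IsIrreducible) : Submodule.span k (Set.range ρ) = ⊤ := by
  classical
  rw [eq_top_iff]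
  rintro T -
  let f : Module.End (Module.End (MonoidAlgebra k G) ρ.asModule) ρ.asModule :=
    { toFun := T
      map_add' := T.map_add
      map_smul' := fun c v ↦ by
        obtain ⟨a, rfl⟩ := (IsSimpleModule.algebraMap_end_bijective_of_isAlgClosed
          (A := MonoidAlgebra k G) (V := ρ.asModule) k).2 c
        exact T.map_smul a v }
  let b := Module.finBasis k V
  obtain ⟨x, hx⟩ := jacobson_density f (Finset.univ.image (b : _ → ρ.asModule))
  have hT : T = ρ.asAlgebraHom x := b.ext fun i ↦
    hx (b i) (Finset.mem_image_of_mem _ (Finset.mem_univ i))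
  rw [hT, asAlgebraHom_def, MonoidAlgebra.lift_apply]
  exact Submodule.sum_mem _ fun g _ ↦ Submodule.smul_mem _ _ (Submodule.subset_span ⟨g, rfl⟩)

end Irreducible

section InvariantForm

variable {k G V : Type*} [Field k] [Group G] [AddCommGroup V] [Module k V]
  {ρ : Representation k G V} {B : V →ₗ[k] V →ₗ[k] k}

/-- A nonzero invariant bilinear form on an irreducible representation is nondegenerate. -/
theorem IsIrreducible.ker_eq_bot_of_invariant (h : ρ.IsIrreducible)
    (hB : ∀ g u v, B (ρ g u) (ρ g v) = B u v) (hB0 : B ≠ 0) : LinearMap.ker B = ⊥ := by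
  refine (h.eq_bot_or_eq_top_of_invariant _ fun g u hu ↦ ?_).resolve_right
    fun h ↦ hB0 (LinearMap.ker_eq_top.mp h)
  ext v
  have := hB g u (ρ g⁻¹ v)
  rw [self_inv_apply] at this
  rw [this, LinearMap.mem_ker.mp hu]
  rfl

/-- Schur's lemma for invariant bilinear forms: they are unique up to a scalar. -/
theorem IsIrreducible.exists_eq_smul_of_invariant [IsAlgClosed k] [FiniteDimensional k V]
    (h : ρ.IsIrreducible) {B' : V →ₗ[k] V →ₗ[k] k}
    (hB : ∀ g u v, B (ρ g u) (ρ g v) = B u v) (hB0 : B ≠ 0)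
    (hB' : ∀ g u v, B' (ρ g u) (ρ g v) = B' u v) : ∃ c : k, B' = c • B := by
  have := h.nontrivial
  let e : V ≃ₗ[k] (V →ₗ[k] k) := LinearMap.linearEquivOfInjective B
    (LinearMap.ker_eq_bot.mp (h.ker_eq_bot_of_invariant hB hB0)) Subspace.dual_finrank_eq.symm
  obtain ⟨c, hc⟩ := Module.End.exists_eigenvalue (K := k) (e.symm.toLinearMap ∘ₗ B')
  obtain ⟨v, hv⟩ := hc.exists_hasEigenvector
  refine ⟨c, sub_eq_zero.mp ?_⟩
  by_contra hne
  have hinv : ∀ g u v, (B' - c • B) (ρ g u) (ρ g v) = (B' - c • B) u v := fun g u v ↦ by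
    simp [hB, hB']
  have hker := h.ker_eq_bot_of_invariant hinv hne
  refine hv.2 ((Submodule.mem_bot k).mp (hker ▸ ?_))
  have h1 : B' v = e (c • v) := e.symm_apply_eq.mp hv.apply_eq_smul
  have h2 : e (c • v) = c • B v := map_smul B c v
  simp [LinearMap.mem_ker, h1, h2]

/-- If every `g : G` is conjugate to its inverse by an element of `H`, then the sum of the
`H`-conjugates of any operator is self-adjoint for every `G`-invariant form. -/
theorem IsIrreducible.sum_conj_isSelfAdjoint [IsAlgClosed k] [FiniteDimensional k V]
    {H : Type*} [Group H] [Fintype H] (φ : H →* G)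
    (hφ : ∀ g, ∃ h, φ h * g * (φ h)⁻¹ = g⁻¹) (h : ρ.IsIrreducible)
    (hB : ∀ g u v, B (ρ g u) (ρ g v) = B u v) (T : V →ₗ[k] V) (u v : V) :
    ∑ h, B (ρ (φ h) (T (ρ (φ h)⁻¹ u))) v = ∑ h, B u (ρ (φ h) (T (ρ (φ h)⁻¹ v))) := by
  have hT : T ∈ Submodule.span k (Set.range ρ) := h.span_range_eq_top ▸ Submodule.mem_top
  induction hT using Submodule.span_induction with
  | zero => simp
  | add S T _ _ hS hT => simp [Finset.sum_add_distrib, hS, hT]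
  | smul c T _ hT => simp [← Finset.mul_sum, hT]
  | mem T hT =>
    obtain ⟨g, rfl⟩ := hT
    obtain ⟨x, hx⟩ := hφ g
    have hadj (y : G) (u v : V) : B (ρ y u) v = B u (ρ y⁻¹ v) := by
      rw [← hB y u, self_inv_apply]
    simp only [← Module.End.mul_apply, ← map_mul, hadj]
    refine Fintype.sum_equiv (Equiv.mulRight x) _ _ fun h ↦ ?_
    congr 2
    simp only [Equiv.coe_mulRight, map_mul, mul_inv_rev, inv_inv, ← hx, mul_assoc]

theorem IntertwiningMap.apply_apply_of_dual (f : IntertwiningMap ρ ρ.dual) (g : G) (u v : V) :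
    f.toLinearMap (ρ g u) (ρ g v) = f.toLinearMap u v := by
  have := LinearMap.congr_fun (f.isIntertwining _ _ g u) (ρ g v)
  simpa [dual_apply, Module.Dual.transpose_apply] using this

/-- Over an algebraically closed field of characteristic zero, an irreducible representation of a
finite group in which every element is conjugate to its inverse carries a nonzero invariant
bilinear form. -/
theorem IsIrreducible.exists_invariant_form [IsAlgClosed k] [CharZero k] [FiniteDimensional k V]
    [Finite G] (hG : ∀ g : G, IsConj g g⁻¹) (h : ρ.IsIrreducible) :
    ∃ B : V →ₗ[k] V →ₗ[k] k, B ≠ 0 ∧ ∀ g u v, B (ρ g u) (ρ g v) = B u v := by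
  have := Fintype.ofFinite G
  have : Invertible (Nat.card G : k) := invertibleOfNonzero (Nat.cast_ne_zero.mpr Nat.card_pos.ne')
  have hchar (g : G) : ρ.character g⁻¹ = ρ.character g := by
    obtain ⟨x, hx⟩ := isConj_iff.mp (hG g)
    rw [← hx, char_conj]
  have hrank : (finrank k (IntertwiningMap ρ ρ.dual) : k) = 1 := by
    rw [← card_inv_mul_sum_char_mul_char_eq_finrank, ← Nat.cast_one,
      ← IsIrreducible.finrank_intertwiningMap_self ρ, ← card_inv_mul_sum_char_mul_char_eq_finrank]
    simp [hchar]
  obtain ⟨f, hf⟩ : ∃ f : IntertwiningMap ρ ρ.dual, f ≠ 0 := by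
    by_contra! hf
    have : Subsingleton (IntertwiningMap ρ ρ.dual) := ⟨fun a b ↦ (hf a).trans (hf b).symm⟩
    simp [finrank_zero_of_subsingleton] at hrank
  exact ⟨f.toLinearMap, fun h0 ↦ hf (IntertwiningMap.ext h0), f.apply_apply_of_dual⟩

theorem IsIrreducible.finrank_intertwiningMap_dual_le_one [IsAlgClosed k] [FiniteDimensional k V]
    (h : ρ.IsIrreducible) : finrank k (IntertwiningMap ρ ρ.dual) ≤ 1 := by
  by_cases hf : ∃ f : IntertwiningMap ρ ρ.dual, f ≠ 0
  · obtain ⟨f, hf⟩ := hf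
    refine finrank_le_one f fun f' ↦ ?_
    obtain ⟨c, hc⟩ := h.exists_eq_smul_of_invariant f.apply_apply_of_dual
      (fun h0 ↦ hf (IntertwiningMap.ext h0)) f'.apply_apply_of_dual
    exact ⟨c, IntertwiningMap.ext hc.symm⟩
  · push Not at hf
    have : Subsingleton (IntertwiningMap ρ ρ.dual) := ⟨fun a b ↦ (hf a).trans (hf b).symm⟩
    simp [finrank_zero_of_subsingleton]

end InvariantForm

section Symplectic

universe u v

/-- Every invariant skew-symmetric bilinear form on a finite-dimensional irreducible
`k`-representation of `G` is zero. -/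
def HasNoSymplecticIrreducible (k : Type*) [Field k] (G : Type*) [Group G] : Prop :=
  ∀ (V : Type u) [AddCommGroup V] [Module k V] [FiniteDimensional k V] (ρ : Representation k G V),
    ρ.IsIrreducible → ∀ B : V →ₗ[k] V →ₗ[k] k,
      (∀ g u v, B (ρ g u) (ρ g v) = B u v) → (∀ u v, B u v = -B v u) → B = 0

variable {k : Type*} [Field k] {G H : Type*} [Group G] [Group H]

theorem HasNoSymplecticIrreducible.of_mulEquiv (e : G ≃* H)
    (hG : HasNoSymplecticIrreducible.{u} k G) : HasNoSymplecticIrreducible.{u} k H := by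
  intro V _ _ _ ρ hρ B hB hskew
  refine hG V (ρ.comp e.toMonoidHom) (isIrreducible_iff_forall_invariant.mpr
    ⟨hρ.nontrivial, fun p hp ↦ hρ.eq_bot_or_eq_top_of_invariant p fun g v hv ↦ ?_⟩) B
    (fun g ↦ hB (e g)) hskew
  simpa using hp (e.symm g) v hv

theorem hasNoSymplecticIrreducible_of_subsingleton [CharZero k] [Subsingleton G] :
    HasNoSymplecticIrreducible.{u} k G := by
  intro V _ _ _ ρ hρ B hB hskew
  have := hρ.nontrivial
  obtain ⟨v, hv⟩ := exists_ne (0 : V)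
  have htop : Submodule.span k {v} = ⊤ :=
    (hρ.eq_bot_or_eq_top_of_invariant _ fun g w hw ↦ by
      simpa [Subsingleton.elim g 1] using hw).resolve_left (by simpa using hv)
  have hvv : B v v = 0 := self_eq_neg.mp (hskew v v)
  ext x y
  obtain ⟨a, rfl⟩ := Submodule.mem_span_singleton.mp (htop ▸ Submodule.mem_top : x ∈ _)
  obtain ⟨b, rfl⟩ := Submodule.mem_span_singleton.mp (htop ▸ Submodule.mem_top : y ∈ _)
  simp [hvv]

/-- If every element of `G` is conjugate to its inverse by an element of `H`, then the absence of
symplectic irreducible representations passes from `H` to `G`. -/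
theorem HasNoSymplecticIrreducible.of_exists_conj_eq_inv [IsAlgClosed k] [CharZero k] [Finite H]
    (φ : H →* G) (hφ : ∀ g, ∃ h, φ h * g * (φ h)⁻¹ = g⁻¹)
    (hH : HasNoSymplecticIrreducible.{u} k H) : HasNoSymplecticIrreducible.{u} k G := by
  intro V _ _ _ ρ hρ B hB hskew
  have := Fintype.ofFinite H
  have := hρ.nontrivial
  obtain ⟨W, hW⟩ := exists_isIrreducible_subrepresentation (ρ.comp φ)
  have hBW (u v : V) (hu : u ∈ W.toSubmodule) (hv : v ∈ W.toSubmodule) : B u v = 0 := by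
    have := hH W.toSubmodule W.toRepresentation hW
      (B.compl₁₂ W.toSubmodule.subtype W.toSubmodule.subtype)
      (fun g u v ↦ hB (φ g) u v) fun u v ↦ hskew u v
    exact LinearMap.congr_fun₂ this ⟨u, hu⟩ ⟨v, hv⟩
  obtain ⟨π, hπ⟩ := W.toSubmodule.subtype.exists_leftInverse_of_injective
    W.toSubmodule.ker_subtype
  have hW' (h : H) {v : V} (hv : v ∈ W.toSubmodule) : ρ (φ h) v ∈ W.toSubmodule :=
    W.apply_mem_toSubmodule h hv
  have := hW.nontrivial
  obtain ⟨⟨w, hw⟩, hw0⟩ := exists_ne (0 : W.toSubmodule)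
  by_contra hB0
  have hker := hρ.ker_eq_bot_of_invariant hB hB0
  refine hw0 (Subtype.ext ((Submodule.mem_bot k).mp (hker ▸ ?_ : w ∈ _)))
  rw [LinearMap.mem_ker]
  ext v
  have hsum := (hρ.sum_conj_isSelfAdjoint φ hφ hB (W.toSubmodule.subtype ∘ₗ π) w v).trans
    (Finset.sum_eq_zero fun h _ ↦ hBW w _ hw (hW' h (π _).2))
  have hfix (h : H) : ρ (φ h) ((W.toSubmodule.subtype ∘ₗ π) (ρ (φ h)⁻¹ w)) = w := by
    have hmem : ρ (φ h)⁻¹ w ∈ W.toSubmodule := by simpa using hW' h⁻¹ hw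
    have : (W.toSubmodule.subtype ∘ₗ π) (ρ (φ h)⁻¹ w) = ρ (φ h)⁻¹ w :=
      congrArg Subtype.val (LinearMap.congr_fun hπ ⟨_, hmem⟩)
    rw [this, self_inv_apply]
  simp only [hfix] at hsum
  simpa using hsum

theorem hasNoSymplecticIrreducible_perm [IsAlgClosed k] [CharZero k] (α : Type*) [Finite α] :
    HasNoSymplecticIrreducible.{u} k (Equiv.Perm α) := by
  induction α using Finite.induction_empty_option with
  | of_equiv e h => exact h.of_mulEquiv e.permCongrHom
  | h_empty => exact hasNoSymplecticIrreducible_of_subsingleton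
  | h_option h =>
    exact h.of_exists_conj_eq_inv _ Equiv.Perm.exists_optionCongr_conj_eq_inv

/-- The absence of symplectic irreducible representations passes to subgroups of index two, provided
every element of the ambient group is conjugate to its inverse. -/
theorem HasNoSymplecticIrreducible.of_index_eq_two {k : Type*} [Field k] [IsAlgClosed k]
    [CharZero k] {G : Type v} [Group G] [Finite G] (hconj : ∀ g : G, IsConj g g⁻¹)
    (A : Subgroup G) (hA : A.index = 2) (hG : HasNoSymplecticIrreducible.{max u v} k G) :
    HasNoSymplecticIrreducible.{u} k A := by
  intro V _ _ _ ρ hρ B hB hskew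
  by_contra hB0
  have := hρ.nontrivial
  have hmul {a b : G} : a * b ∈ A ↔ (a ∈ A ↔ b ∈ A) := A.mul_mem_iff_of_index_two hA
  obtain ⟨s, hs⟩ : ∃ s, s ∉ A := by
    by_contra! h
    have := Subgroup.index_eq_one.mpr ((Subgroup.eq_top_iff' A).mpr h)
    omega
  have : Nontrivial (coindV A.subtype ρ) := by
    classical
    obtain ⟨v, hv⟩ := exists_ne (0 : V)
    refine ⟨⟨fun g ↦ if hg : g ∈ A then ρ ⟨g, hg⟩ v else 0, fun a g ↦ ?_⟩, 0, fun h ↦ hv ?_⟩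
    · by_cases hg : g ∈ A
      · have hag : (a : G) * g ∈ A := A.mul_mem a.2 hg
        have : (⟨a * g, hag⟩ : A) = a * ⟨g, hg⟩ := rfl
        simp only [Subgroup.coe_subtype, hg, hag, dif_pos, this, map_mul, Module.End.mul_apply]
      · simp [hg, hmul]
    · have := congrFun (congrArg Subtype.val h) 1
      have hone : (⟨1, A.one_mem⟩ : A) = 1 := rfl
      simpa [hone] using (dif_pos A.one_mem).symm.trans this
  have := Fintype.ofFinite G
  have : FiniteDimensional k (coindV A.subtype ρ) := inferInstance
  obtain ⟨W, hW⟩ := exists_isIrreducible_subrepresentation (coind A.subtype ρ)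
  have := hW.nontrivial
  let σ := W.toRepresentation
  -- evaluation at the identity
  let f : W.toSubmodule →ₗ[k] V :=
    LinearMap.proj 1 ∘ₗ (coindV A.subtype ρ).subtype ∘ₗ W.toSubmodule.subtype
  have hf (g : G) (w : W.toSubmodule) : f (σ g w) = w.1.1 g := by
    change w.1.1 (1 * g) = _
    rw [one_mul]
  have hfA (a : A) (w : W.toSubmodule) : f (σ a w) = ρ a (f w) := by
    rw [hf]
    have := w.1.2 a 1
    rw [mul_one] at this
    exact this
  have hker (w : W.toSubmodule) (h : ∀ g, f (σ g w) = 0) : w = 0 :=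
    Subtype.ext (Subtype.ext (funext fun g ↦ (hf g w).symm.trans (h g)))
  have hsurj : LinearMap.range f = ⊤ := by
    refine (hρ.eq_bot_or_eq_top_of_invariant _ ?_).resolve_left fun h ↦ ?_
    · rintro a _ ⟨w, rfl⟩
      exact ⟨σ a w, hfA a w⟩
    · obtain ⟨w, hw⟩ := exists_ne (0 : W.toSubmodule)
      exact hw (hker w fun g ↦ LinearMap.congr_fun (LinearMap.range_eq_bot.mp h) _)
  let C := B.compl₁₂ f f
  have hCA (a : G) (ha : a ∈ A) (u v : W.toSubmodule) : C (σ a u) (σ a v) = C u v := by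
    change B (f (σ (⟨a, ha⟩ : A) u)) (f (σ (⟨a, ha⟩ : A) v)) = B (f u) (f v)
    rw [hfA, hfA, hB]
  have hsum : C + C.compl₁₂ (σ s) (σ s) = 0 := by
    refine hG W.toSubmodule σ hW _ (fun g u v ↦ ?_) fun u v ↦ ?_
    · simp only [LinearMap.add_apply, LinearMap.compl₁₂_apply]
      by_cases hg : g ∈ A
      · have hsg : s * g * s⁻¹ ∈ A := by simp [hmul, hg]
        have := hCA _ hsg (σ s u) (σ s v)
        simp only [← Module.End.mul_apply, ← map_mul, inv_mul_cancel_right] at this ⊢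
        rw [this, hCA g hg]
      · have hsg : s * g ∈ A := by simp [hmul, hg, hs]
        have hgs : g * s⁻¹ ∈ A := by simp [hmul, hg, hs]
        have h1 := hCA _ hsg u v
        have h2 := hCA _ hgs (σ s u) (σ s v)
        simp only [← Module.End.mul_apply, ← map_mul, inv_mul_cancel_right] at h1 h2 ⊢
        rw [h1, h2, add_comm]
    · simp only [LinearMap.add_apply, LinearMap.compl₁₂_apply, C, neg_add]
      rw [← hskew, ← hskew]
  have hCs (u v : W.toSubmodule) : C (σ s u) (σ s v) = -C u v :=
    eq_neg_of_add_eq_zero_right (LinearMap.congr_fun₂ hsum u v)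
  have hC0 : C ≠ 0 := by
    intro hC
    refine hB0 (LinearMap.ext₂ fun x y ↦ ?_)
    obtain ⟨u, rfl⟩ := LinearMap.range_eq_top.mp hsurj x
    obtain ⟨v, rfl⟩ := LinearMap.range_eq_top.mp hsurj y
    exact LinearMap.congr_fun₂ hC u v
  have hfker (w : W.toSubmodule) : f w = 0 ↔ C w = 0 := by
    refine ⟨fun h ↦ LinearMap.ext fun v ↦ by simp [C, h], fun h ↦ ?_⟩
    rw [← Submodule.mem_bot k, ← hρ.ker_eq_bot_of_invariant hB hB0, LinearMap.mem_ker]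
    ext y
    obtain ⟨v, rfl⟩ := LinearMap.range_eq_top.mp hsurj y
    exact LinearMap.congr_fun h v
  have hinj : LinearMap.ker f = ⊥ := by
    refine (hW.eq_bot_or_eq_top_of_invariant _ fun g w hw ↦ ?_).resolve_right fun h ↦ hC0 ?_
    · rw [LinearMap.mem_ker, hfker] at hw ⊢
      ext v
      obtain ⟨v, rfl⟩ : ∃ v', σ g v' = v := ⟨σ g⁻¹ v, self_inv_apply _ _ _⟩
      by_cases hg : g ∈ A
      · exact (hCA g hg w v).trans (LinearMap.congr_fun hw v)
      · have hgs : g * s⁻¹ ∈ A := by simp [hmul, hg, hs]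
        have := hCA _ hgs (σ s w) (σ s v)
        simp only [← Module.End.mul_apply, ← map_mul, inv_mul_cancel_right] at this
        refine this.trans ?_
        rw [hCs, hw]
        simp
    · ext u v
      simp [C, LinearMap.ker_eq_top.mp h]
  have hres : IsIrreducible (k := k) (G := A) (V := W.toSubmodule) (MonoidHom.comp σ A.subtype) :=
    hρ.of_ker_eq_bot_of_range_eq_top f hfA hinj hsurj
  obtain ⟨D, hD0, hD⟩ := hW.exists_invariant_form hconj
  obtain ⟨c, hc⟩ := hres.exists_eq_smul_of_invariant (B' := C) (fun a ↦ hD a) hD0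
    (fun a ↦ hCA a a.2)
  refine hC0 (LinearMap.ext₂ fun u v ↦ self_eq_neg.mp ?_)
  rw [← hCs, hc]
  simp only [LinearMap.smul_apply]
  exact congrArg _ (hD s u v).symm

end Symplectic

section FrobeniusSchur

variable {k G V : Type*} [Field k] [Group G] [Fintype G] [AddCommGroup V] [Module k V]
  [FiniteDimensional k V] {ρ : Representation k G V}

/-- If all invariant bilinear forms are symmetric, then the Frobenius–Schur sum is the sum of the
squares of the character values. -/
theorem sum_character_sq_of_forall_symm
    (hsymm : ∀ B : V →ₗ[k] V →ₗ[k] k, (∀ g u v, B (ρ g u) (ρ g v) = B u v) →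
      ∀ u v, B u v = B v u) :
    ∑ g : G, ρ.character (g ^ 2) = ∑ g : G, ρ.character g ^ 2 := by
  let b := finBasis k V
  let M (g : G) := LinearMap.toMatrix b b (ρ g)
  have hM (g : G) (i j) : M g i j = b.repr (ρ g (b j)) i := LinearMap.toMatrix_apply ..
  have hswap (i j) : ∑ g, M g i j * M g j i = ∑ g, M g i i * M g j j := by
    let F : V →ₗ[k] V →ₗ[k] k :=
      ∑ g, (LinearMap.mul k k).compl₁₂ (b.coord i ∘ₗ ρ g) (b.coord j ∘ₗ ρ g)
    have hF (u v : V) : F u v = ∑ g, b.repr (ρ g u) i * b.repr (ρ g v) j := by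
      simp [F, LinearMap.sum_apply]
    have := hsymm F (fun x u v ↦ ?_) (b j) (b i)
    · simpa only [hF, ← hM] using this
    · simp only [hF, ← Module.End.mul_apply, ← map_mul]
      exact Fintype.sum_equiv (Equiv.mulRight x) _ _ fun _ ↦ rfl
  have htr (g : G) : ρ.character g = ∑ i, M g i i :=
    LinearMap.trace_eq_matrix_trace k b _
  have htr2 (g : G) : ρ.character (g ^ 2) = ∑ i, ∑ j, M g i j * M g j i := by
    rw [character, LinearMap.trace_eq_matrix_trace k b, sq, map_mul, LinearMap.toMatrix_mul]
    simp [Matrix.trace, Matrix.mul_apply, M]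
  simp only [htr2]
  simp only [htr, sq, Finset.sum_mul_sum]
  rw [Finset.sum_comm, Finset.sum_comm (s := Finset.univ (α := G))]
  refine Finset.sum_congr rfl fun i _ ↦ ?_
  rw [Finset.sum_comm, Finset.sum_comm (s := Finset.univ (α := G))]
  exact Finset.sum_congr rfl fun j _ ↦ hswap i j

/-- If `G` has no symplectic irreducible representation, then the Frobenius–Schur indicator of every
irreducible representation of `G` is `0` or `1`. -/
theorem HasNoSymplecticIrreducible.frobeniusSchur_eq_zero_or_one {k : Type*} [Field k]
    [IsAlgClosed k] [CharZero k] {G : Type*} [Group G] [Fintype G] {V : Type u} [AddCommGroup V]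
    [Module k V] [FiniteDimensional k V] {ρ : Representation k G V}
    (hG : HasNoSymplecticIrreducible.{u} k G) (h : ρ.IsIrreducible) :
    (Fintype.card G : k)⁻¹ * ∑ g : G, ρ.character (g ^ 2) = 0 ∨
      (Fintype.card G : k)⁻¹ * ∑ g : G, ρ.character (g ^ 2) = 1 := by
  have : Invertible (Nat.card G : k) := invertibleOfNonzero (Nat.cast_ne_zero.mpr Nat.card_pos.ne')
  have hsymm (B : V →ₗ[k] V →ₗ[k] k) (hB : ∀ g u v, B (ρ g u) (ρ g v) = B u v) (u v : V) :
      B u v = B v u := by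
    have := hG V ρ h (B - B.flip) (fun g u v ↦ by simp [hB]) fun u v ↦ by simp
    exact sub_eq_zero.mp (LinearMap.congr_fun₂ this u v)
  have hrank : (Fintype.card G : k)⁻¹ * ∑ g : G, ρ.character (g ^ 2) =
      finrank k (IntertwiningMap ρ ρ.dual) := by
    rw [sum_character_sq_of_forall_symm hsymm, ← card_inv_mul_sum_char_mul_char_eq_finrank,
      Nat.card_eq_fintype_card]
    congr 1
    refine Fintype.sum_equiv (Equiv.inv G) _ _ fun g ↦ ?_
    simp [char_dual, sq]
  have hle := h.finrank_intertwiningMap_dual_le_one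
  rw [hrank]
  interval_cases finrank k (IntertwiningMap ρ ρ.dual) <;> simp

end FrobeniusSchur

end Representation

theorem FDRep.isIrreducible_of_simple {k G : Type*} [Field k] [Group G] (V : FDRep k G)
    [Simple V] : Representation.IsIrreducible (k := k) (G := G) (V := V) V.ρ := by
  refine Representation.isIrreducible_iff_forall_invariant.mpr ⟨?_, fun p hp ↦ ?_⟩
  · by_contra h
    rw [not_nontrivial_iff_subsingleton] at h
    refine id_nonzero V ?_
    ext v
    exact Subsingleton.elim (α := V) _ _
  · let σ : Representation k G p :=
      { toFun g := (V.ρ g).restrict (hp g)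
        map_one' := by ext; simp
        map_mul' g h := by ext; simp }
    let i : FDRep.of σ ⟶ V :=
      ⟨InducedCategory.homMk (ModuleCat.ofHom p.subtype), fun g ↦ by ext; rfl⟩
    have hi : Function.Injective i := p.subtype_injective
    have : Mono i := ConcreteCategory.mono_of_injective i hi
    by_cases h0 : i = 0
    · left
      rw [eq_bot_iff]
      intro v hv
      exact congrArg (fun j : FDRep.of σ ⟶ V ↦ j (⟨v, hv⟩ : p)) h0
    · right
      have := isIso_of_mono_of_nonzero h0
      rw [eq_top_iff]
      intro v _
      obtain ⟨w, rfl⟩ := (ConcreteCategory.bijective_of_isIso i).2 v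
      exact w.2

/-- For `n ≥ 5` the alternating group `Aₙ` has no irreducible complex representation of
quaternionic type: every irreducible complex character `χ` of `Aₙ` satisfies
`ν₂(χ) ∈ {0, 1}`, i.e. no irreducible character of `Aₙ` has Frobenius–Schur
indicator `−1`. -/
theorem alternatingGroup_no_quaternionic_character
    (n : ℕ) (hn : 5 ≤ n)
    (V : FDRep ℂ (alternatingGroup (Fin n))) (hV : Simple V) :
    frobeniusSchurIndicator V.character = 0 ∨ frobeniusSchurIndicator V.character = 1 := by
  have : Nontrivial (Fin n) := Fin.nontrivial_iff_two_le.mpr (by omega)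
  refine Representation.HasNoSymplecticIrreducible.frobeniusSchur_eq_zero_or_one
    (Representation.HasNoSymplecticIrreducible.of_index_eq_two (fun g ↦ ?_) _
      alternatingGroup.index_eq_two (Representation.hasNoSymplecticIrreducible_perm _))
    V.isIrreducible_of_simple
  rw [Equiv.Perm.isConj_iff_cycleType_eq, Equiv.Perm.cycleType_inv]
end
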